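/- arXiv:hep-th/9308153 — 5 statements merged into one kernel-verified Lean document; each statement's English description precedes it below -/
import Mathlib

section
/- Let F be a field, A an associative unital F-algebra, σ an F-algebra automorphism of A, V an F-vector space, and tr : A → V an F-linear map with tr(ab) = tr(ba) for all a,b ∈ A. Define the F-bilinear map Ψ_{σ,tr} on the twisted Laurent polynomial algebra A_σ[z,z⁻¹] by Ψ_{σ,tr}(z^r a, z^{−r} b) = tr((1 + σ + ⋯ + σ^{r−1})(σ^{−r}(a)·b)) for r > 0, Ψ_{σ,tr}(z^{−r} b, z^r a) = −Ψ_{σ,tr}(z^r a, z^{−r} b) for r > 0, and Ψ_{σ,tr}(z^r a, z^s b) = 0 whenever r + s ≠ 0 or r = s = 0. Then Ψ_{σ,tr} is a V-valued 2-cocycle on the Lie algebra Ã_σ obtained from A_σ[z,z⁻¹] with the commutator bracket [x,y]' = xy − yx: it is skew-symmetric and satisfies Ψ_{σ,tr}([x,y]', u) + Ψ_{σ,tr}([y,u]', x) + Ψ_{σ,tr}([u,x]', y) = 0 for all x, y, u. -/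
/-- The twisted Laurent polynomial algebra `A_σ[z,z⁻¹]`: finitely supported functions
`ℤ → A` (finite sums `Σ_j z^j a_j`) with multiplication
`(z^k a)(z^m b) = z^{k+m} σ^m(a) b`. -/
noncomputable def twMul {F : Type*} [Field F] {A : Type*} [Ring A] [Algebra F A]
    (σ : A ≃ₐ[F] A) (x y : ℤ →₀ A) : ℤ →₀ A :=
  x.sum fun k a => y.sum fun m b => Finsupp.single (k + m) ((σ ^ m) a * b)

/-- The `V`-valued `F`-bilinear map `Ψ_{σ,tr}` on `A_σ[z,z⁻¹]`, determined by
`Ψ(z^r a, z^{-r} b) = tr((1 + σ + ⋯ + σ^{r-1})(σ^{-r}(a)·b))` for `r > 0`,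
skew-symmetry in that case, and `Ψ(z^r a, z^s b) = 0` if `r + s ≠ 0` or `r = s = 0`. -/
noncomputable def twPsi {F : Type*} [Field F] {A : Type*} [Ring A] [Algebra F A]
    {V : Type*} [AddCommGroup V] [Module F V]
    (σ : A ≃ₐ[F] A) (tr : A →ₗ[F] V) (x y : ℤ →₀ A) : V :=
  x.sum fun r a => y.sum fun s b =>
    if 0 < r ∧ s = -r then
      tr (∑ i ∈ Finset.range r.toNat, (σ ^ (i : ℤ)) ((σ ^ (-r)) a * b))
    else if 0 < s ∧ r = -s then
      - tr (∑ i ∈ Finset.range s.toNat, (σ ^ (i : ℤ)) ((σ ^ (-s)) b * a))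
    else 0

section TwistedCocycle

variable {F : Type*} [Field F] {A : Type*} [Ring A] [Algebra F A]
  {V : Type*} [AddCommGroup V] [Module F V]

/-- The operator `(σ^r - 1)/(σ - 1)` for an arbitrary integer `r`: it is
`1 + σ + ⋯ + σ^{r-1}` for `r ≥ 0` and `-(σ^r + ⋯ + σ^{-1})` for `r ≤ 0`. -/
noncomputable def twSum (σ : A ≃ₐ[F] A) (r : ℤ) (a : A) : A :=
  ∑ i ∈ Finset.Ico 0 r, (σ ^ i) a - ∑ i ∈ Finset.Ico r 0, (σ ^ i) a

@[simp] lemma twSum_zero (σ : A ≃ₐ[F] A) (a : A) : twSum σ 0 a = 0 := by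
  simp [twSum]

@[simp] lemma twSum_apply_zero (σ : A ≃ₐ[F] A) (r : ℤ) : twSum σ r 0 = 0 := by
  simp [twSum]

lemma twSum_apply_add (σ : A ≃ₐ[F] A) (r : ℤ) (a b : A) :
    twSum σ r (a + b) = twSum σ r a + twSum σ r b := by
  simp only [twSum, map_add, Finset.sum_add_distrib]
  abel

lemma twSum_add_one (σ : A ≃ₐ[F] A) (r : ℤ) (a : A) :
    twSum σ (r + 1) a = twSum σ r a + (σ ^ r) a := by
  unfold twSum
  rcases le_or_gt 0 r with h | h
  · have h₁ : Finset.Ico 0 (r + 1) = insert r (Finset.Ico 0 r) := by ext; simp; lia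
    rw [h₁, Finset.sum_insert (by simp), Finset.Ico_eq_empty (by lia : ¬ r + 1 < 0),
      Finset.Ico_eq_empty (by lia : ¬ r < 0)]
    simp [add_comm]
  · have h₁ : Finset.Ico r 0 = insert r (Finset.Ico (r + 1) 0) := by ext; simp; lia
    rw [h₁, Finset.sum_insert (by simp), Finset.Ico_eq_empty (by lia : ¬ 0 < r + 1),
      Finset.Ico_eq_empty (by lia : ¬ 0 < r)]
    simp

lemma zpow_apply_zpow_apply (σ : A ≃ₐ[F] A) (r s : ℤ) (a : A) :
    (σ ^ r) ((σ ^ s) a) = (σ ^ (r + s)) a := by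
  rw [zpow_add, AlgEquiv.mul_apply]

lemma twSum_add (σ : A ≃ₐ[F] A) (r s : ℤ) (a : A) :
    twSum σ (r + s) a = twSum σ r a + twSum σ s ((σ ^ r) a) := by
  have key (t : ℤ) : (σ ^ t) ((σ ^ r) a) = (σ ^ (r + t)) a := by
    rw [zpow_apply_zpow_apply, add_comm]
  induction s with
  | zero => simp
  | succ n ih => rw [← add_assoc, twSum_add_one, ih, twSum_add_one, key, add_assoc]
  | pred n ih =>
    have h₁ := twSum_add_one σ (r + (-(n : ℤ) - 1)) a
    have h₂ := twSum_add_one σ (-(n : ℤ) - 1) ((σ ^ r) a)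
    rw [key] at h₂
    rw [show r + (-(n : ℤ) - 1) + 1 = r + -n by ring, ih] at h₁
    rw [sub_add_cancel] at h₂
    rw [h₂, ← add_assoc] at h₁
    exact (add_right_cancel h₁).symm

lemma twSum_natCast (σ : A ≃ₐ[F] A) (n : ℕ) (a : A) :
    twSum σ n a = ∑ i ∈ Finset.range n, (σ ^ (i : ℤ)) a := by
  induction n with
  | zero => simp
  | succ n ih => rw [Finset.sum_range_succ, ← ih, Nat.cast_succ, twSum_add_one]

lemma trace_twSum_mul_comm (σ : A ≃ₐ[F] A) {tr : A →ₗ[F] V}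
    (htr : ∀ a b : A, tr (a * b) = tr (b * a)) (r : ℤ) (a b : A) :
    tr (twSum σ r (a * b)) = tr (twSum σ r (b * a)) := by
  simp only [twSum, map_sub, map_sum, map_mul]
  congr 1 <;> exact Finset.sum_congr rfl fun i _ => htr _ _

/-- The closed form of `twPsi` on monomials, uniform in the sign of the exponents. -/
lemma twPsi_eq_sum (σ : A ≃ₐ[F] A) {tr : A →ₗ[F] V}
    (htr : ∀ a b : A, tr (a * b) = tr (b * a)) (x y : ℤ →₀ A) :
    twPsi σ tr x y = x.sum fun r a => y.sum fun s b =>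
      if r + s = 0 then tr (twSum σ r ((σ ^ s) a * b)) else 0 := by
  refine Finsupp.sum_congr fun r _ => Finsupp.sum_congr fun s _ => ?_
  generalize x r = a
  generalize y s = b
  split_ifs with h₁ h₂ h₂ h₃ h₃
  · obtain ⟨hr, rfl⟩ := h₁
    rw [← twSum_natCast, Int.toNat_of_nonneg hr.le]
  · lia
  · obtain ⟨hs, rfl⟩ := h₂
    have h := twSum_add σ s (-s) (a * (σ ^ (-s)) b)
    rw [add_neg_cancel, twSum_zero, map_mul, zpow_apply_zpow_apply, add_neg_cancel, zpow_zero,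
      AlgEquiv.one_apply] at h
    rw [← twSum_natCast, Int.toNat_of_nonneg hs.le, trace_twSum_mul_comm σ htr,
      ← map_neg, neg_eq_of_add_eq_zero_right h.symm]
  · lia
  · obtain rfl : r = 0 := by lia
    simp
  · rfl

lemma twPsi_zero_left (σ : A ≃ₐ[F] A) (tr : A →ₗ[F] V) (y : ℤ →₀ A) :
    twPsi σ tr 0 y = 0 := by
  simp [twPsi]

lemma twPsi_zero_right (σ : A ≃ₐ[F] A) (tr : A →ₗ[F] V) (x : ℤ →₀ A) :
    twPsi σ tr x 0 = 0 := by
  simp [twPsi]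

lemma twPsi_add_left (σ : A ≃ₐ[F] A) {tr : A →ₗ[F] V}
    (htr : ∀ a b : A, tr (a * b) = tr (b * a)) (x x' y : ℤ →₀ A) :
    twPsi σ tr (x + x') y = twPsi σ tr x y + twPsi σ tr x' y := by
  simp only [twPsi_eq_sum σ htr]
  refine Finsupp.sum_add_index' (by simp) fun r a a' => ?_
  rw [← Finsupp.sum_add]
  refine Finsupp.sum_congr fun s _ => ?_
  split_ifs <;> simp [add_mul, twSum_apply_add]

lemma twPsi_add_right (σ : A ≃ₐ[F] A) {tr : A →ₗ[F] V}
    (htr : ∀ a b : A, tr (a * b) = tr (b * a)) (x y y' : ℤ →₀ A) :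
    twPsi σ tr x (y + y') = twPsi σ tr x y + twPsi σ tr x y' := by
  simp only [twPsi_eq_sum σ htr]
  rw [← Finsupp.sum_add]
  refine Finsupp.sum_congr fun r _ => ?_
  refine Finsupp.sum_add_index' (by simp) fun s b b' => ?_
  split_ifs <;> simp [mul_add, twSum_apply_add]

lemma twPsi_sub_left (σ : A ≃ₐ[F] A) {tr : A →ₗ[F] V}
    (htr : ∀ a b : A, tr (a * b) = tr (b * a)) (x x' y : ℤ →₀ A) :
    twPsi σ tr (x - x') y = twPsi σ tr x y - twPsi σ tr x' y := by
  rw [eq_sub_iff_add_eq, ← twPsi_add_left σ htr, sub_add_cancel]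

lemma twPsi_single (σ : A ≃ₐ[F] A) {tr : A →ₗ[F] V}
    (htr : ∀ a b : A, tr (a * b) = tr (b * a)) (r s : ℤ) (a b : A) :
    twPsi σ tr (Finsupp.single r a) (Finsupp.single s b) =
      if r + s = 0 then tr (twSum σ r ((σ ^ s) a * b)) else 0 := by
  rw [twPsi_eq_sum σ htr, Finsupp.sum_single_index (by simp), Finsupp.sum_single_index (by simp)]

lemma twMul_zero_left (σ : A ≃ₐ[F] A) (y : ℤ →₀ A) : twMul σ 0 y = 0 := by
  simp [twMul]

lemma twMul_zero_right (σ : A ≃ₐ[F] A) (x : ℤ →₀ A) : twMul σ x 0 = 0 := by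
  simp [twMul]

lemma twMul_add_left (σ : A ≃ₐ[F] A) (x x' y : ℤ →₀ A) :
    twMul σ (x + x') y = twMul σ x y + twMul σ x' y := by
  refine Finsupp.sum_add_index' (by simp) fun k a a' => ?_
  rw [← Finsupp.sum_add]
  simp [add_mul]

lemma twMul_add_right (σ : A ≃ₐ[F] A) (x y y' : ℤ →₀ A) :
    twMul σ x (y + y') = twMul σ x y + twMul σ x y' := by
  unfold twMul
  rw [← Finsupp.sum_add]
  exact Finsupp.sum_congr fun k _ =>
    Finsupp.sum_add_index' (by simp) fun m b b' => by simp [mul_add]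

lemma twMul_single (σ : A ≃ₐ[F] A) (k m : ℤ) (a b : A) :
    twMul σ (Finsupp.single k a) (Finsupp.single m b) =
      Finsupp.single (k + m) ((σ ^ m) a * b) := by
  rw [twMul, Finsupp.sum_single_index (by simp), Finsupp.sum_single_index (by simp)]

lemma twPsi_skew (σ : A ≃ₐ[F] A) {tr : A →ₗ[F] V}
    (htr : ∀ a b : A, tr (a * b) = tr (b * a)) (x y : ℤ →₀ A) :
    twPsi σ tr x y = - twPsi σ tr y x := by
  induction x using Finsupp.induction_linear with
  | zero => simp [twPsi_zero_left, twPsi_zero_right]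
  | add x x' hx hx' =>
    rw [twPsi_add_left σ htr, twPsi_add_right σ htr, hx, hx', neg_add]
  | single r a =>
    induction y using Finsupp.induction_linear with
    | zero => simp [twPsi_zero_left, twPsi_zero_right]
    | add y y' hy hy' =>
      rw [twPsi_add_left σ htr, twPsi_add_right σ htr, hy, hy', neg_add]
    | single s b =>
      rw [twPsi_single σ htr, twPsi_single σ htr, add_comm s r]
      split_ifs with h
      · obtain rfl : s = -r := by lia
        have h := twSum_add σ r (-r) ((σ ^ (-r)) a * b)
        rw [add_neg_cancel, twSum_zero, map_mul, zpow_apply_zpow_apply, add_neg_cancel, zpow_zero,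
          AlgEquiv.one_apply] at h
        rw [trace_twSum_mul_comm σ htr (-r), ← map_neg, neg_eq_of_add_eq_zero_left h.symm]
      · simp

/-- `twPsi` is a cyclic cocycle on the associative algebra of twisted Laurent polynomials. -/
lemma twPsi_cyclic (σ : A ≃ₐ[F] A) {tr : A →ₗ[F] V}
    (htr : ∀ a b : A, tr (a * b) = tr (b * a)) (x y u : ℤ →₀ A) :
    twPsi σ tr (twMul σ x y) u + twPsi σ tr (twMul σ y u) x
      + twPsi σ tr (twMul σ u x) y = 0 := by
  induction x using Finsupp.induction_linear with
  | zero => simp [twPsi_zero_left, twPsi_zero_right, twMul_zero_left, twMul_zero_right]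
  | add x x' hx hx' =>
    simp only [twMul_add_left, twMul_add_right, twPsi_add_left σ htr, twPsi_add_right σ htr]
    rw [← add_zero (0 : V)]
    nth_rw 1 [← hx]
    rw [← hx']
    abel
  | single k a =>
  induction y using Finsupp.induction_linear with
  | zero => simp [twPsi_zero_left, twPsi_zero_right, twMul_zero_left, twMul_zero_right]
  | add y y' hy hy' =>
    simp only [twMul_add_left, twMul_add_right, twPsi_add_left σ htr, twPsi_add_right σ htr]
    rw [← add_zero (0 : V)]
    nth_rw 1 [← hy]
    rw [← hy']
    abel
  | single m b =>
  induction u using Finsupp.induction_linear with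
  | zero => simp [twPsi_zero_left, twPsi_zero_right, twMul_zero_left, twMul_zero_right]
  | add u u' hu hu' =>
    simp only [twMul_add_left, twMul_add_right, twPsi_add_left σ htr, twPsi_add_right σ htr]
    rw [← add_zero (0 : V)]
    nth_rw 1 [← hu]
    rw [← hu']
    abel
  | single n c =>
  simp only [twMul_single, twPsi_single σ htr]
  by_cases h : k + m + n = 0
  · rw [if_pos h, if_pos (by lia), if_pos (by lia)]
    obtain rfl : n = -k - m := by lia
    have h₁ := twSum_add σ (k + m) (-m) ((σ ^ (-k)) a * (σ ^ (-k - m)) b * c)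
    have h₂ := twSum_add σ k (-k) ((σ ^ (-k)) a * (σ ^ (-k - m)) b * c)
    simp only [map_mul, zpow_apply_zpow_apply] at h₁ h₂ ⊢
    rw [trace_twSum_mul_comm σ htr _ _ a, ← mul_assoc, mul_assoc _ _ b,
      trace_twSum_mul_comm σ htr _ _ (_ * b)]
    rw [show k + m + -k = m by ring, show k + m + (-k - m) = 0 by ring,
      show k + m + -m = k by ring, zpow_zero, AlgEquiv.one_apply] at h₁
    rw [show k + -k = 0 by ring, show k + (-k - m) = -m by ring, twSum_zero,
      zpow_zero, AlgEquiv.one_apply] at h₂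
    rw [show m + (-k - m) = -k by ring, show -k - m + k = -m by ring,
      show -k - m + m = -k by ring, show k + (-k - m) = -m by ring, add_comm m k,
      ← map_add, ← map_add, add_right_comm, ← h₁, ← h₂, map_zero]
  · rw [if_neg h, if_neg (by lia), if_neg (by lia)]
    simp

end TwistedCocycle

/-- If `tr : A → V` is an `F`-linear trace (`tr(ab) = tr(ba)`), then `Ψ_{σ,tr}` is a
`V`-valued 2-cocycle on the Lie algebra `Ã_σ` obtained from `A_σ[z,z⁻¹]` with the
commutator bracket `[x,y]' = xy - yx`: it is skew-symmetric and satisfies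
`Ψ([x,y]',u) + Ψ([y,u]',x) + Ψ([u,x]',y) = 0`. -/
theorem twPsi_is_two_cocycle
    (F : Type*) [Field F] (A : Type*) [Ring A] [Algebra F A]
    (V : Type*) [AddCommGroup V] [Module F V]
    (σ : A ≃ₐ[F] A) (tr : A →ₗ[F] V) (htr : ∀ a b : A, tr (a * b) = tr (b * a)) :
    (∀ x y : ℤ →₀ A, twPsi σ tr x y = - twPsi σ tr y x) ∧
    (∀ x y u : ℤ →₀ A,
      twPsi σ tr (twMul σ x y - twMul σ y x) u
        + twPsi σ tr (twMul σ y u - twMul σ u y) x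
        + twPsi σ tr (twMul σ u x - twMul σ x u) y = 0) := by
  refine ⟨twPsi_skew σ htr, fun x y u => ?_⟩
  simp only [twPsi_sub_left σ htr]
  have h₁ := twPsi_cyclic σ htr x y u
  have h₂ := twPsi_cyclic σ htr y x u
  rw [← sub_zero (0 : V)]
  nth_rw 1 [← h₁]
  rw [← h₂]
  abel
end

section
/- The bilinear form Ψ on the Lie algebra 𝒟 is a 2-cocycle: Ψ is skew-symmetric and Ψ([a,b], u) + Ψ([b,u], a) + Ψ([u,a], b) = 0 for all a, b, u ∈ 𝒟, where [a,b] = ab − ba is the commutator. -/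
/-- The operator `z^k f(D)` on `ℂ[z,z⁻¹]` (Laurent polynomials realized as finitely
supported functions `ℤ → ℂ` on the basis `z^n ↔ single n 1`): it sends `z^n` to
`f(n)·z^{n+k}`.  Here `D = z∂_z` is `opE 0 X`. -/
noncomputable def opE (k : ℤ) (f : Polynomial ℂ) : Module.End ℂ (ℤ →₀ ℂ) :=
  Finsupp.lsum ℂ fun n => Polynomial.eval ((n : ℤ) : ℂ) f • Finsupp.lsingle (n + k)

/-- The Lie algebra `𝒟` of regular differential operators on `ℂ^×`: the linear span of
the operators `z^k f(D)` in `End(ℂ[z,z⁻¹])`, with the commutator bracket. -/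
noncomputable def Dcal : Submodule ℂ (Module.End ℂ (ℤ →₀ ℂ)) :=
  Submodule.span ℂ {T | ∃ (k : ℤ) (f : Polynomial ℂ), T = opE k f}

/-- `Ψ` is a bilinear form on `End(ℂ[z,z⁻¹])` satisfying the defining relations of the
2-cocycle of `𝒟`: `Ψ(z^r f(D), z^{-r} g(D)) = Σ_{j=-r}^{-1} f(j)g(j+r)` for `r > 0`
(written below via `j = i - r`, `0 ≤ i < r`), the skew counterpart, and
`Ψ(z^r f(D), z^s g(D)) = 0` if `r + s ≠ 0` or `r = s = 0`.  These relations determine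
`Ψ` uniquely on `𝒟`. -/
def RelPsi (Ψ : Module.End ℂ (ℤ →₀ ℂ) →ₗ[ℂ] Module.End ℂ (ℤ →₀ ℂ) →ₗ[ℂ] ℂ) : Prop :=
  (∀ r : ℤ, 0 < r → ∀ f g : Polynomial ℂ,
    Ψ (opE r f) (opE (-r) g)
      = ∑ i ∈ Finset.range r.toNat,
          f.eval ((((i : ℤ) - r : ℤ)) : ℂ) * g.eval ((i : ℕ) : ℂ)) ∧
  (∀ r : ℤ, 0 < r → ∀ f g : Polynomial ℂ,
    Ψ (opE (-r) f) (opE r g)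
      = - ∑ i ∈ Finset.range r.toNat,
          g.eval ((((i : ℤ) - r : ℤ)) : ℂ) * f.eval ((i : ℕ) : ℂ)) ∧
  (∀ r s : ℤ, r + s ≠ 0 → ∀ f g : Polynomial ℂ, Ψ (opE r f) (opE s g) = 0) ∧
  (∀ f g : Polynomial ℂ, Ψ (opE 0 f) (opE 0 g) = 0)

theorem opE_single (k : ℤ) (f : Polynomial ℂ) (n : ℤ) (c : ℂ) :
    opE k f (Finsupp.single n c) = Finsupp.single (n + k) (f.eval (n : ℂ) * c) := by
  simp [opE]

theorem opE_sub (k : ℤ) (f g : Polynomial ℂ) : opE k (f - g) = opE k f - opE k g := by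
  refine Finsupp.lhom_ext fun n c => ?_
  simp only [LinearMap.sub_apply, opE_single, Polynomial.eval_sub, sub_mul, Finsupp.single_sub]

theorem opE_mul (r s : ℤ) (f g : Polynomial ℂ) :
    opE r f * opE s g = opE (r + s) (f.comp (Polynomial.X + Polynomial.C (s : ℂ)) * g) := by
  refine Finsupp.lhom_ext fun n c => ?_
  simp only [Module.End.mul_apply, opE_single, Polynomial.eval_mul, Polynomial.eval_comp,
    Polynomial.eval_add, Polynomial.eval_X, Polynomial.eval_C, Int.cast_add, mul_assoc]
  rw [add_assoc, add_comm s r]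

theorem opE_lie (r s : ℤ) (f g : Polynomial ℂ) :
    ⁅opE r f, opE s g⁆ = opE (r + s) (f.comp (Polynomial.X + Polynomial.C (s : ℂ)) * g -
      g.comp (Polynomial.X + Polynomial.C (r : ℂ)) * f) := by
  rw [Ring.lie_def, opE_mul, opE_mul, opE_sub, add_comm s r]

theorem exists_int_antidifference (F : ℤ → ℂ) : ∃ G : ℤ → ℂ, ∀ n, G (n + 1) - G n = F n := by
  refine ⟨fun n => ∑ i ∈ Finset.range n.toNat, F i -
    ∑ i ∈ Finset.range (-n).toNat, F (-(i : ℤ) - 1), fun n => ?_⟩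
  rcases le_or_gt 0 n with h | h
  · lift n to ℕ using h
    have h₁ : ((n : ℤ) + 1).toNat = n + 1 := by omega
    have h₂ : (-((n : ℤ) + 1)).toNat = 0 := by omega
    have h₃ : (-(n : ℤ)).toNat = 0 := by omega
    simp only [h₁, h₂, h₃, Int.toNat_natCast, Finset.sum_range_succ, Finset.range_zero,
      Finset.sum_empty]
    ring
  · obtain ⟨m, rfl⟩ : ∃ m : ℕ, n = -(m : ℤ) - 1 := ⟨(-n - 1).toNat, by omega⟩
    have h₁ : (-(m : ℤ) - 1 + 1).toNat = 0 := by omega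
    have h₂ : (-(-(m : ℤ) - 1 + 1)).toNat = m := by omega
    have h₃ : (-(m : ℤ) - 1).toNat = 0 := by omega
    have h₄ : (-(-(m : ℤ) - 1)).toNat = m + 1 := by omega
    simp only [h₁, h₂, h₃, h₄, Finset.sum_range_succ, Finset.range_zero, Finset.sum_empty]
    ring

theorem sum_range_eq_of_antidifference {F G : ℤ → ℂ} (hG : ∀ n, G (n + 1) - G n = F n)
    (a : ℤ) (m : ℕ) : ∑ i ∈ Finset.range m, F (i + a) = G (m + a) - G a := by
  have h := Finset.sum_range_sub (fun i : ℕ => G (i + a)) m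
  simp only [Nat.cast_zero, zero_add] at h
  rw [← h]
  refine Finset.sum_congr rfl fun i _ => ?_
  rw [← hG, Nat.cast_succ, add_right_comm]

namespace RelPsi

variable {Ψ : Module.End ℂ (ℤ →₀ ℂ) →ₗ[ℂ] Module.End ℂ (ℤ →₀ ℂ) →ₗ[ℂ] ℂ}

theorem apply_opE_eq (hΨ : RelPsi Ψ) {r s : ℤ} (hrs : r + s = 0) {f g : Polynomial ℂ}
    {G : ℤ → ℂ} (hG : ∀ n : ℤ, G (n + 1) - G n = f.eval (n : ℂ) * g.eval ((n + r : ℤ) : ℂ)) :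
    Ψ (opE r f) (opE s g) = G 0 - G s := by
  obtain ⟨hpos, hneg, -, hzero⟩ := hΨ
  rcases lt_trichotomy 0 r with h | rfl | h
  · obtain rfl : s = -r := by omega
    have key := sum_range_eq_of_antidifference hG (-r) r.toNat
    rw [Int.toNat_of_nonneg h.le, add_neg_cancel] at key
    rw [hpos r h, ← key]
    refine Finset.sum_congr rfl fun i _ => ?_
    rw [neg_add_cancel_right, sub_eq_add_neg, Int.cast_natCast]
  · obtain rfl : s = 0 := by omega
    rw [hzero, sub_self]
  · obtain rfl : r = -s := by omega
    have hs : 0 < s := by omega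
    have key := sum_range_eq_of_antidifference hG 0 s.toNat
    rw [Int.toNat_of_nonneg hs.le, add_zero] at key
    rw [hneg s hs, ← neg_sub, ← key]
    congr 1
    refine Finset.sum_congr rfl fun i _ => ?_
    rw [add_zero, ← sub_eq_add_neg, Int.cast_natCast, mul_comm]

theorem opE_skew (hΨ : RelPsi Ψ) (r s : ℤ) (f g : Polynomial ℂ) :
    Ψ (opE r f) (opE s g) = - Ψ (opE s g) (opE r f) := by
  by_cases hrs : r + s = 0
  · obtain ⟨G, hG⟩ := exists_int_antidifference
      fun n => f.eval (n : ℂ) * g.eval ((n + r : ℤ) : ℂ)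
    rw [hΨ.apply_opE_eq hrs hG,
      hΨ.apply_opE_eq (G := fun n => G (n + s)) (by omega : s + r = 0) fun n => ?_]
    · simp only [hrs, zero_add, neg_sub]
    · rw [add_right_comm, hG, mul_comm, add_assoc, add_comm s r, hrs, add_zero]
  · rw [hΨ.2.2.1 r s hrs, hΨ.2.2.1 s r (by omega), neg_zero]

theorem opE_jacobi (hΨ : RelPsi Ψ) (r s t : ℤ) (f g h : Polynomial ℂ) :
    Ψ ⁅opE r f, opE s g⁆ (opE t h) + Ψ ⁅opE s g, opE t h⁆ (opE r f) +
      Ψ ⁅opE t h, opE r f⁆ (opE s g) = 0 := by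
  simp only [opE_lie]
  by_cases hrst : r + s + t = 0
  · obtain ⟨P, hP⟩ := exists_int_antidifference fun n =>
      f.eval ((n + s : ℤ) : ℂ) * g.eval (n : ℂ) * h.eval ((n + r + s : ℤ) : ℂ)
    obtain ⟨Q, hQ⟩ := exists_int_antidifference fun n =>
      f.eval (n : ℂ) * g.eval ((n + r : ℤ) : ℂ) * h.eval ((n + r + s : ℤ) : ℂ)
    obtain rfl : t = -r - s := by omega
    rw [hΨ.apply_opE_eq (G := fun n => P n - Q n) hrst fun n => ?_,
      hΨ.apply_opE_eq (G := fun n => P (n - r - s) - Q (n - r)) (by omega) fun n => ?_,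
      hΨ.apply_opE_eq (G := fun n => P (n - s) - Q (n - r - s)) (by omega) fun n => ?_]
    · ring_nf
    · have hPn := hP (n - s)
      have hQn := hQ (n - r - s)
      simp only [Polynomial.eval_sub, Polynomial.eval_mul, Polynomial.eval_comp,
        Polynomial.eval_add, Polynomial.eval_X, Polynomial.eval_C]
      push_cast at hPn hQn ⊢
      ring_nf at hPn hQn ⊢
      linear_combination hPn - hQn
    · have hPn := hP (n - r - s)
      have hQn := hQ (n - r)
      simp only [Polynomial.eval_sub, Polynomial.eval_mul, Polynomial.eval_comp,
        Polynomial.eval_add, Polynomial.eval_X, Polynomial.eval_C]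
      push_cast at hPn hQn ⊢
      ring_nf at hPn hQn ⊢
      linear_combination hPn - hQn
    · have hPn := hP n
      have hQn := hQ n
      simp only [Polynomial.eval_sub, Polynomial.eval_mul, Polynomial.eval_comp,
        Polynomial.eval_add, Polynomial.eval_X, Polynomial.eval_C]
      push_cast at hPn hQn ⊢
      ring_nf at hPn hQn ⊢
      linear_combination hPn - hQn
  · rw [hΨ.2.2.1 _ _ hrst, hΨ.2.2.1 _ _ (by omega), hΨ.2.2.1 _ _ (by omega)]
    simp

end RelPsi

/-- The bilinear form `Ψ` is a 2-cocycle on the Lie algebra `𝒟`: it is skew-symmetric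
and satisfies `Ψ([a,b],u) + Ψ([b,u],a) + Ψ([u,a],b) = 0` on `𝒟`, where `[a,b] = ab-ba`
is the commutator. -/
theorem Psi_is_two_cocycle_on_Dcal
    (Ψ : Module.End ℂ (ℤ →₀ ℂ) →ₗ[ℂ] Module.End ℂ (ℤ →₀ ℂ) →ₗ[ℂ] ℂ)
    (hΨ : RelPsi Ψ) :
    (∀ a ∈ Dcal, ∀ b ∈ Dcal, Ψ a b = - Ψ b a) ∧
    (∀ a ∈ Dcal, ∀ b ∈ Dcal, ∀ u ∈ Dcal,
      Ψ ⁅a, b⁆ u + Ψ ⁅b, u⁆ a + Ψ ⁅u, a⁆ b = 0) := by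
  constructor
  · intro a ha b hb
    rw [Dcal] at ha hb
    induction ha, hb using Submodule.span_induction₂ with
    | mem_mem x y hx hy =>
      obtain ⟨r, f, rfl⟩ := hx
      obtain ⟨s, g, rfl⟩ := hy
      exact hΨ.opE_skew r s f g
    | zero_left y hy => simp
    | zero_right x hx => simp
    | add_left x y z _ _ _ h₁ h₂ => simp [h₁, h₂, add_comm]
    | add_right x y z _ _ _ h₁ h₂ => simp [h₁, h₂, add_comm]
    | smul_left c x y _ _ h => simp [h]
    | smul_right c x y _ _ h => simp [h]
  · intro a ha b hb u hu
    rw [Dcal] at ha hb hu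
    simp only [Ring.lie_def]
    induction ha, hb using Submodule.span_induction₂ with
    | mem_mem x y hx hy =>
      obtain ⟨r, f, rfl⟩ := hx
      obtain ⟨s, g, rfl⟩ := hy
      induction hu using Submodule.span_induction with
      | mem z hz =>
        obtain ⟨t, h, rfl⟩ := hz
        simpa only [Ring.lie_def] using hΨ.opE_jacobi r s t f g h
      | zero => simp
      | add x y _ _ h₁ h₂ =>
        simp only [map_sub, LinearMap.sub_apply, mul_add, add_mul, map_add,
          LinearMap.add_apply] at h₁ h₂ ⊢
        linear_combination h₁ + h₂
      | smul c x _ h =>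
        simp only [map_sub, LinearMap.sub_apply, smul_mul_assoc, mul_smul_comm, map_smul,
          LinearMap.smul_apply, smul_eq_mul] at h ⊢
        linear_combination c * h
    | zero_left y hy => simp
    | zero_right x hx => simp
    | add_left x y z _ _ _ h₁ h₂ =>
      simp only [map_sub, LinearMap.sub_apply, mul_add, add_mul, map_add,
        LinearMap.add_apply] at h₁ h₂ ⊢
      linear_combination h₁ + h₂
    | add_right x y z _ _ _ h₁ h₂ =>
      simp only [map_sub, LinearMap.sub_apply, mul_add, add_mul, map_add,
        LinearMap.add_apply] at h₁ h₂ ⊢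
      linear_combination h₁ + h₂
    | smul_left c x y _ _ h =>
      simp only [map_sub, LinearMap.sub_apply, smul_mul_assoc, mul_smul_comm, map_smul,
        LinearMap.smul_apply, smul_eq_mul] at h ⊢
      linear_combination c * h
    | smul_right c x y _ _ h =>
      simp only [map_sub, LinearMap.sub_apply, smul_mul_assoc, mul_smul_comm, map_smul,
        LinearMap.smul_apply, smul_eq_mul] at h ⊢
      linear_combination c * h
end

section
/- Let 𝔭 be a parabolic subalgebra of 𝒟̂. Then the ideal I_{−k} of ℂ[w] with 𝔭_{−k} = z^{−k}·I_{−k} is nonzero for every k ≥ 1, and the characteristic polynomials b_k of 𝔭 satisfy: (a) b_k(w) divides both b_{k+1}(w) and b_{k+1}(w+1) for every k ≥ 1; (b) b_{k+l}(w) divides b_k(w−l)·b_l(w) for all k, l ≥ 1. -/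
/-- The Lie algebra `𝒟̂ = 𝒟 ⊕ ℂC`, modelled concretely: an element `Σ_k z^k f_k(D) + cC`
is the pair `(Σ_k single k f_k, c)` in `(ℤ →₀ ℂ[w]) × ℂ` (here `z^k f(D) ↔ single k f`). -/
abbrev DhatA : Type := (ℤ →₀ Polynomial ℂ) × ℂ

/-- The associative product of `𝒟ᵃ` in the model `ℤ →₀ ℂ[w]`:
`(z^k f(D))(z^m g(D)) = z^{k+m} f(D+m) g(D)`. -/
noncomputable def twMulD (x y : ℤ →₀ Polynomial ℂ) : ℤ →₀ Polynomial ℂ :=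
  x.sum fun k f => y.sum fun m g =>
    Finsupp.single (k + m) (f.comp (Polynomial.X + Polynomial.C (m : ℂ)) * g)

/-- The 2-cocycle `Ψ` of `𝒟`:
`Ψ(z^r f(D), z^{-r} g(D)) = Σ_{j=-r}^{-1} f(j)g(j+r)` for `r > 0` (below `j = i - r`),
skew-symmetry, and `Ψ(z^r f(D), z^s g(D)) = 0` if `r + s ≠ 0` or `r = s = 0`. -/
noncomputable def PsiD (x y : ℤ →₀ Polynomial ℂ) : ℂ :=
  x.sum fun r f => y.sum fun s g =>
    if 0 < r ∧ s = -r then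
      ∑ i ∈ Finset.range r.toNat,
        f.eval ((((i : ℤ) - r : ℤ)) : ℂ) * g.eval ((i : ℕ) : ℂ)
    else if 0 < s ∧ r = -s then
      -(∑ i ∈ Finset.range s.toNat,
        g.eval ((((i : ℤ) - s : ℤ)) : ℂ) * f.eval ((i : ℕ) : ℂ))
    else 0

/-- The bracket of `𝒟̂`: `[a, b] = ab - ba + Ψ(a,b)·C` for `a, b ∈ 𝒟`, with `C` central. -/
noncomputable def hatBracket (x y : DhatA) : DhatA :=
  (twMulD x.1 y.1 - twMulD y.1 x.1, PsiD x.1 y.1)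

/-- A parabolic subalgebra of `𝒟̂`: a graded Lie subalgebra `𝔭 = ⊕_j 𝔭_j` with
`𝔭_j = 𝒟̂_j` for all `j ≥ 0` (in particular `ℂC ⊆ 𝔭`) and `𝔭_j ≠ 0` for some `j < 0`. -/
structure IsParabolic (p : Submodule ℂ DhatA) : Prop where
  /-- `𝔭` is closed under the bracket of `𝒟̂`. -/
  closed : ∀ x ∈ p, ∀ y ∈ p, hatBracket x y ∈ p
  /-- `𝔭` is graded: the degree-`j` component of any element of `𝔭` lies in `𝔭`. -/
  graded : ∀ x ∈ p, ∀ j : ℤ,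
    ((Finsupp.single j (x.1 j), if j = 0 then x.2 else 0) : DhatA) ∈ p
  /-- `𝔭_j = 𝒟̂_j` for `j ≥ 0`. -/
  nonneg : ∀ j : ℤ, 0 ≤ j → ∀ f : Polynomial ℂ, ((Finsupp.single j f, 0) : DhatA) ∈ p
  /-- `C ∈ 𝔭` (part of `𝔭_0 = 𝒟̂_0`). -/
  central_mem : ∀ c : ℂ, (((0 : ℤ →₀ Polynomial ℂ), c) : DhatA) ∈ p
  /-- `𝔭_j ≠ 0` for some `j < 0`. -/
  neg : ∃ (j : ℤ) (f : Polynomial ℂ), j < 0 ∧ f ≠ 0 ∧ ((Finsupp.single j f, 0) : DhatA) ∈ p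

/-- The degree-`j` component of a subspace `p` of `𝒟̂`, without its central part:
all polynomials `f` with `z^j f(D) ∈ p`. -/
noncomputable def gradedComponent (p : Submodule ℂ DhatA) (j : ℤ) : Submodule ℂ (Polynomial ℂ) :=
  p.comap (LinearMap.inl ℂ (ℤ →₀ Polynomial ℂ) ℂ ∘ₗ Finsupp.lsingle j)

theorem twMulD_single (a b : ℤ) (f g : Polynomial ℂ) :
    twMulD (Finsupp.single a f) (Finsupp.single b g) =
      Finsupp.single (a + b) (f.comp (Polynomial.X + Polynomial.C (b : ℂ)) * g) := by
  unfold twMulD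
  rw [Finsupp.sum_single_index (by simp), Finsupp.sum_single_index (by simp)]

namespace IsParabolic

open Polynomial

variable {p : Submodule ℂ DhatA} {a b : ℤ} {f g : ℂ[X]}

theorem bracket_mem (hp : IsParabolic p) (hf : f ∈ gradedComponent p a)
    (hg : g ∈ gradedComponent p b) :
    f.comp (X + C (b : ℂ)) * g - g.comp (X + C (a : ℂ)) * f ∈ gradedComponent p (a + b) := by
  have e : hatBracket (Finsupp.single a f, 0) (Finsupp.single b g, 0) -
      (0, PsiD (Finsupp.single a f) (Finsupp.single b g)) =
      (Finsupp.single (a + b) (f.comp (X + C (b : ℂ)) * g - g.comp (X + C (a : ℂ)) * f), 0) := by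
    simp only [hatBracket, twMulD_single, add_comm b a, Prod.mk_sub_mk, sub_zero, sub_self,
      Finsupp.single_sub]
  change ((Finsupp.single (a + b) _, 0) : DhatA) ∈ p
  rw [← e]
  exact p.sub_mem (hp.closed _ hf _ hg) (hp.central_mem _)

theorem X_mul_mem (hp : IsParabolic p) (ha : a ≠ 0) (hf : f ∈ gradedComponent p a) :
    X * f ∈ gradedComponent p a := by
  have hX : (X ^ 2 : ℂ[X]) ∈ gradedComponent p 0 := hp.nonneg 0 le_rfl _
  have h := hp.bracket_mem hX hf
  rw [zero_add] at h
  have ha' : (a : ℂ) ≠ 0 := Int.cast_ne_zero.mpr ha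
  have e : X * f = (2 * (a : ℂ))⁻¹ • (((X ^ 2).comp (X + C (a : ℂ)) * f -
      f.comp (X + C ((0 : ℤ) : ℂ)) * X ^ 2) - (a : ℂ) ^ 2 • f) := by
    rw [eq_inv_smul_iff₀ (mul_ne_zero two_ne_zero ha')]
    simp only [smul_eq_C_mul, Int.cast_zero, C_0, add_zero, comp_X, pow_comp, X_comp, C_mul,
      C_pow, C_ofNat]
    ring
  rw [e]
  exact Submodule.smul_mem _ _ (Submodule.sub_mem _ h (Submodule.smul_mem _ _ hf))

theorem mul_mem (hp : IsParabolic p) (ha : a ≠ 0) (g : ℂ[X]) (hf : f ∈ gradedComponent p a) :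
    g * f ∈ gradedComponent p a := by
  induction g using Polynomial.induction_on' with
  | add q r hq hr => rw [add_mul]; exact Submodule.add_mem _ hq hr
  | monomial n c =>
    rw [← C_mul_X_pow_eq_monomial, mul_assoc, ← smul_eq_C_mul]
    refine Submodule.smul_mem _ _ ?_
    induction n with
    | zero => simpa using hf
    | succ n ih => rw [pow_succ', mul_assoc]; exact hp.X_mul_mem ha ih

theorem mul_comp_mem (hp : IsParabolic p) (ha : a ≠ 0) (hb : b ≠ 0) (hab : a + b ≠ 0)
    (hf : f ∈ gradedComponent p a) (hg : g ∈ gradedComponent p b) :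
    g.comp (X + C (a : ℂ)) * f ∈ gradedComponent p (a + b) := by
  have h := hp.mul_mem hab X (hp.bracket_mem hf hg)
  have h' := hp.bracket_mem hf (hp.X_mul_mem hb hg)
  have ha' : (a : ℂ) ≠ 0 := Int.cast_ne_zero.mpr ha
  have e : g.comp (X + C (a : ℂ)) * f = (a : ℂ)⁻¹ •
      (X * (f.comp (X + C (b : ℂ)) * g - g.comp (X + C (a : ℂ)) * f) -
        (f.comp (X + C (b : ℂ)) * (X * g) - (X * g).comp (X + C (a : ℂ)) * f)) := by
    rw [eq_inv_smul_iff₀ ha']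
    simp only [smul_eq_C_mul, mul_comp, X_comp]
    ring
  rw [e]
  exact Submodule.smul_mem _ _ (Submodule.sub_mem _ h h')

theorem mem_of_mem_succ (hp : IsParabolic p) {k : ℕ} (hk : 1 ≤ k)
    (hf : f ∈ gradedComponent p (-((k + 1 : ℕ) : ℤ))) :
    f ∈ gradedComponent p (-(k : ℤ)) ∧ f.comp (X + 1) ∈ gradedComponent p (-(k : ℤ)) := by
  have h1 : (1 : ℂ[X]) ∈ gradedComponent p 1 := hp.nonneg 1 zero_le_one _
  have e : -((k + 1 : ℕ) : ℤ) + 1 = -(k : ℤ) := by push_cast; ring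
  have h := hp.mul_comp_mem (by lia) one_ne_zero (by lia) hf h1
  have h' := hp.mul_comp_mem one_ne_zero (by lia) (by lia) h1 hf
  rw [e] at h
  rw [add_comm, e] at h'
  exact ⟨by simpa using h, by simpa using h'⟩

theorem comp_mul_mem (hp : IsParabolic p) {k l : ℕ} (hk : 1 ≤ k) (hl : 1 ≤ l)
    (hf : f ∈ gradedComponent p (-(k : ℤ))) (hg : g ∈ gradedComponent p (-(l : ℤ))) :
    f.comp (X - C (l : ℂ)) * g ∈ gradedComponent p (-((k + l : ℕ) : ℤ)) := by
  have h := hp.mul_comp_mem (by lia) (by lia) (by lia) hg hf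
  have e : -(l : ℤ) + -(k : ℤ) = -((k + l : ℕ) : ℤ) := by push_cast; ring
  rw [e] at h
  simpa [sub_eq_add_neg] using h

theorem exists_ne_zero_mem (hp : IsParabolic p) {k : ℕ} (hk : 1 ≤ k) :
    ∃ f ≠ 0, f ∈ gradedComponent p (-(k : ℤ)) := by
  have base : ∃ f ≠ 0, f ∈ gradedComponent p (-((1 : ℕ) : ℤ)) := by
    obtain ⟨j, f, hj, hf0, hf⟩ := hp.neg
    obtain ⟨n, rfl⟩ : ∃ n : ℕ, j = -((1 + n : ℕ) : ℤ) := ⟨(-j - 1).toNat, by lia⟩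
    refine ⟨f, hf0, ?_⟩
    change f ∈ gradedComponent p _ at hf
    clear hj
    induction n with
    | zero => exact hf
    | succ n ih => exact ih (hp.mem_of_mem_succ (by lia) hf).1
  induction k, hk using Nat.le_induction with
  | base => exact base
  | succ k hk ih =>
    obtain ⟨f, hf0, hf⟩ := ih
    obtain ⟨g, hg0, hg⟩ := base
    refine ⟨_, mul_ne_zero ?_ hg0, hp.comp_mul_mem hk le_rfl hf hg⟩
    rw [Ne, comp_eq_zero_iff]
    rintro (h | ⟨-, h⟩)
    · exact hf0 h
    · have h' := congrArg natDegree h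
      rw [natDegree_X_sub_C, natDegree_C] at h'
      exact one_ne_zero h'

end IsParabolic

/-- Let `𝔭` be a parabolic subalgebra of `𝒟̂`.  Then each `𝔭_{-k} = z^{-k}·I_{-k}`
(`k ≥ 1`) is given by a nonzero ideal `I_{-k}` of `ℂ[w]`, and the characteristic
polynomials `b_k` (the monic generators of the `I_{-k}`) satisfy:
(a) `b_k(w)` divides `b_{k+1}(w)` and `b_{k+1}(w+1)` for every `k ≥ 1`;
(b) `b_{k+l}(w)` divides `b_k(w-l)·b_l(w)` for all `k, l ≥ 1`. -/
theorem parabolic_characteristic_polynomials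
    (p : Submodule ℂ DhatA) (hp : IsParabolic p) :
    -- `I_{-k} = {f | z^{-k} f(D) ∈ 𝔭}` is an ideal of `ℂ[w]`, and it is nonzero
    (∀ k : ℕ, 1 ≤ k →
      (∀ f g : Polynomial ℂ, ((Finsupp.single (-(k : ℤ)) f, (0 : ℂ)) : DhatA) ∈ p →
        ((Finsupp.single (-(k : ℤ)) (g * f), (0 : ℂ)) : DhatA) ∈ p) ∧
      (∃ f : Polynomial ℂ, f ≠ 0 ∧ ((Finsupp.single (-(k : ℤ)) f, (0 : ℂ)) : DhatA) ∈ p)) ∧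
    -- divisibility properties of the characteristic polynomials
    (∀ b : ℕ → Polynomial ℂ,
      (∀ k : ℕ, 1 ≤ k → (b k).Monic ∧
        (∀ f : Polynomial ℂ,
          ((Finsupp.single (-(k : ℤ)) f, (0 : ℂ)) : DhatA) ∈ p ↔ b k ∣ f)) →
      -- (a)
      (∀ k : ℕ, 1 ≤ k →
        b k ∣ b (k + 1) ∧ b k ∣ (b (k + 1)).comp (Polynomial.X + 1)) ∧
      -- (b)
      (∀ k l : ℕ, 1 ≤ k → 1 ≤ l →
        b (k + l) ∣ (b k).comp (Polynomial.X - Polynomial.C (l : ℂ)) * b l)) := by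
  refine ⟨fun k hk => ⟨fun f g hf => hp.mul_mem (by lia) g hf, hp.exists_ne_zero_mem hk⟩,
    fun b hb => ⟨fun k hk => ?_, fun k l hk hl => ?_⟩⟩
  · have h := hp.mem_of_mem_succ hk (((hb (k + 1) (by lia)).2 _).2 dvd_rfl)
    exact ⟨((hb k hk).2 _).1 h.1, ((hb k hk).2 _).1 h.2⟩
  · exact ((hb (k + l) (by lia)).2 _).1 (hp.comp_mul_mem hk hl
      (((hb k hk).2 _).2 dvd_rfl) (((hb l hl).2 _).2 dvd_rfl))
end

section
/- Let b ∈ ℂ[w] be monic and let 𝔭 be a parabolic subalgebra of 𝒟̂ whose first characteristic polynomial b_1 equals b. Then for every k ≥ 1 the k-th characteristic polynomial b_k of 𝔭 divides b(w)·b(w−1)⋯b(w−k+1), and lcm{b(w), b(w−1), …, b(w−k+1)} divides b_k(w). In particular, if the difference of any two distinct roots of b is not an integer, then b_k(w) = b(w)·b(w−1)⋯b(w−k+1) for every k ≥ 1, so 𝔭 is uniquely determined by b. -/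
open Polynomial in
lemma twMulD_single_s8 (k m : ℤ) (f g : ℂ[X]) :
    twMulD (Finsupp.single k f) (Finsupp.single m g) =
      Finsupp.single (k + m) (f.comp (X + C (m : ℂ)) * g) := by
  simp [twMulD]

namespace IsParabolic

open Polynomial

variable {p : Submodule ℂ DhatA}

/-- In nonzero degree the bracket of homogeneous elements has no central component. -/
lemma single_bracket_mem (hp : IsParabolic p) {k m n : ℤ} (hn : k + m = n) (h0 : n ≠ 0)
    {f g : ℂ[X]} (hf : ((Finsupp.single k f, 0) : DhatA) ∈ p)
    (hg : ((Finsupp.single m g, 0) : DhatA) ∈ p) :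
    ((Finsupp.single n (f.comp (X + C (m : ℂ)) * g - g.comp (X + C (k : ℂ)) * f), 0) : DhatA)
      ∈ p := by
  have h := hp.graded _ (hp.closed _ hf _ hg) n
  subst hn
  simpa [hatBracket, twMulD_single_s8, h0, add_comm m k] using h

lemma single_add_mem {n : ℤ} {f g : ℂ[X]} (hf : ((Finsupp.single n f, 0) : DhatA) ∈ p)
    (hg : ((Finsupp.single n g, 0) : DhatA) ∈ p) :
    ((Finsupp.single n (f + g), 0) : DhatA) ∈ p := by
  simpa [Finsupp.single_add] using p.add_mem hf hg

lemma single_C_mul_mem {n : ℤ} (c : ℂ) {f : ℂ[X]}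
    (hf : ((Finsupp.single n f, 0) : DhatA) ∈ p) :
    ((Finsupp.single n (C c * f), 0) : DhatA) ∈ p := by
  simpa [Finsupp.smul_single, smul_eq_C_mul] using p.smul_mem c hf

lemma single_sub_mem {n : ℤ} {f g : ℂ[X]} (hf : ((Finsupp.single n f, 0) : DhatA) ∈ p)
    (hg : ((Finsupp.single n g, 0) : DhatA) ∈ p) :
    ((Finsupp.single n (f - g), 0) : DhatA) ∈ p := by
  simpa [Finsupp.single_sub] using p.sub_mem hf hg

lemma of_single_C_mul_mem {n : ℤ} {c : ℂ} (hc : c ≠ 0) {f : ℂ[X]}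
    (hf : ((Finsupp.single n (C c * f), 0) : DhatA) ∈ p) :
    ((Finsupp.single n f, 0) : DhatA) ∈ p := by
  have h := single_C_mul_mem c⁻¹ hf
  rwa [← mul_assoc, ← C_mul, inv_mul_cancel₀ hc, C_1, one_mul] at h

lemma single_X_mul_mem (hp : IsParabolic p) {n : ℤ} (hn : n ≠ 0) {f : ℂ[X]}
    (hf : ((Finsupp.single n f, 0) : DhatA) ∈ p) :
    ((Finsupp.single n (X * f), 0) : DhatA) ∈ p := by
  have h := hp.single_bracket_mem (zero_add n) hn (hp.nonneg 0 le_rfl (X ^ 2)) hf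
  have hc : (2 * n : ℂ) ≠ 0 := by simpa using hn
  refine of_single_C_mul_mem hc ?_
  convert single_sub_mem h (single_C_mul_mem ((n : ℂ) ^ 2) hf) using 3
  simp [map_ofNat C 2]
  ring

lemma single_mul_mem (hp : IsParabolic p) {n : ℤ} (hn : n ≠ 0) (q : ℂ[X]) {f : ℂ[X]}
    (hf : ((Finsupp.single n f, 0) : DhatA) ∈ p) :
    ((Finsupp.single n (q * f), 0) : DhatA) ∈ p := by
  induction q using Polynomial.induction_on' with
  | add q r hq hr => rw [add_mul]; exact single_add_mem hq hr
  | monomial k c =>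
    rw [← C_mul_X_pow_eq_monomial, mul_assoc]
    refine single_C_mul_mem c ?_
    induction k with
    | zero => simpa using hf
    | succ k ih => rw [pow_succ', mul_assoc]; exact hp.single_X_mul_mem hn ih

lemma single_mem_of_dvd (hp : IsParabolic p) {n : ℤ} (hn : n ≠ 0) {f g : ℂ[X]} (hfg : f ∣ g)
    (hf : ((Finsupp.single n f, 0) : DhatA) ∈ p) :
    ((Finsupp.single n g, 0) : DhatA) ∈ p := by
  obtain ⟨q, rfl⟩ := hfg
  rw [mul_comm]
  exact hp.single_mul_mem hn q hf

lemma single_prod_shift_mem (hp : IsParabolic p) {b : ℂ[X]}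
    (hb : ((Finsupp.single (-1) b, 0) : DhatA) ∈ p) {k : ℕ} (hk : 1 ≤ k) :
    ((Finsupp.single (-(k : ℤ)) (∏ i ∈ Finset.range k, b.comp (X - C (i : ℂ))), 0) : DhatA)
      ∈ p := by
  induction k, hk using Nat.le_induction with
  | base => simpa using hb
  | succ k hk ih =>
    have h := hp.single_bracket_mem (n := -((k + 1 : ℕ) : ℤ)) (by push_cast; ring) (by omega)
      (hp.single_X_mul_mem (by norm_num) hb) ih
    have hc : (-(k : ℂ)) ≠ 0 := neg_ne_zero.2 (Nat.cast_ne_zero.2 (by omega))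
    refine of_single_C_mul_mem hc ?_
    convert h using 3
    have hshift : (∏ i ∈ Finset.range k, b.comp (X - C (i : ℂ))).comp (X + C ((-1 : ℤ) : ℂ)) * b =
        ∏ i ∈ Finset.range (k + 1), b.comp (X - C (i : ℂ)) := by
      rw [Finset.prod_range_succ', prod_comp]
      congr 1
      · refine Finset.prod_congr rfl fun i _ => ?_
        rw [comp_assoc]
        congr 1
        simp
        ring
      · simp
    have hlast : b.comp (X + C ((-(k : ℤ) : ℤ) : ℂ)) = b.comp (X - C (k : ℂ)) := by
      congr 1
      simp [sub_eq_add_neg]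
    rw [mul_left_comm _ X b, hshift, mul_comp, X_comp, hlast, Finset.prod_range_succ]
    simp
    ring

/-- Bracketing with `z` and `zD` passes from degree `-(k+1)` to degree `-k`. -/
lemma single_mem_and_shift_mem (hp : IsParabolic p) {k : ℕ} (hk : 1 ≤ k) {f : ℂ[X]}
    (hf : ((Finsupp.single (-((k + 1 : ℕ) : ℤ)) f, 0) : DhatA) ∈ p) :
    ((Finsupp.single (-(k : ℤ)) f, 0) : DhatA) ∈ p ∧
      ((Finsupp.single (-(k : ℤ)) (f.comp (X + 1)), 0) : DhatA) ∈ p := by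
  have hk0 : -(k : ℤ) ≠ 0 := by omega
  have hdeg : 1 + -((k + 1 : ℕ) : ℤ) = -(k : ℤ) := by push_cast; ring
  have h₁ := hp.single_bracket_mem hdeg hk0 (hp.nonneg 1 zero_le_one 1) hf
  have h₂ := hp.single_bracket_mem hdeg hk0 (hp.nonneg 1 zero_le_one X) hf
  have hc : ((k + 1 : ℕ) : ℂ) ≠ 0 := Nat.cast_ne_zero.2 (by omega)
  have h₃ : ((Finsupp.single (-(k : ℤ)) f, 0) : DhatA) ∈ p := by
    refine of_single_C_mul_mem hc ?_
    convert single_sub_mem (hp.single_X_mul_mem hk0 h₁) h₂ using 3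
    simp
    ring
  refine ⟨h₃, ?_⟩
  convert single_sub_mem h₃ h₁ using 3
  simp

lemma shift_dvd_of_single_mem (hp : IsParabolic p) {b : ℂ[X]}
    (hb : ∀ f : ℂ[X], ((Finsupp.single (-1) f, 0) : DhatA) ∈ p → b ∣ f) {k : ℕ} (hk : 1 ≤ k)
    {f : ℂ[X]} (hf : ((Finsupp.single (-(k : ℤ)) f, 0) : DhatA) ∈ p) {i : ℕ} (hi : i < k) :
    b.comp (X - C (i : ℂ)) ∣ f := by
  induction k, hk using Nat.le_induction generalizing f i with
  | base =>
    obtain rfl : i = 0 := by omega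
    simpa using hb f (by simpa using hf)
  | succ k hk ih =>
    obtain ⟨h₁, h₂⟩ := hp.single_mem_and_shift_mem hk hf
    rcases Nat.lt_succ_iff_lt_or_eq.1 hi with hi | rfl
    · exact ih h₁ hi
    · obtain ⟨i, rfl⟩ := Nat.exists_eq_add_of_le' hk
      obtain ⟨q, hq⟩ := ih h₂ (Nat.lt_succ_self i)
      refine ⟨q.comp (X - 1), ?_⟩
      have h := congrArg (fun r : ℂ[X] => r.comp (X - 1)) hq
      simp only [mul_comp, comp_assoc] at h
      convert h using 2
      · simp
      · congr 1
        simp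
        ring

lemma mem_of_single_mem (hp : IsParabolic p) {x : DhatA}
    (h : ∀ j < 0, ((Finsupp.single j (x.1 j), 0) : DhatA) ∈ p) : x ∈ p := by
  have hx : x = (∑ j ∈ x.1.support, ((Finsupp.single j (x.1 j), 0) : DhatA)) + (0, x.2) := by
    refine Prod.ext ?_ ?_
    · rw [Prod.fst_add, Prod.fst_sum, add_zero]
      exact (Finsupp.sum_single x.1).symm
    · simp [Prod.snd_sum]
  rw [hx]
  refine p.add_mem (p.sum_mem fun j _ => ?_) (hp.central_mem _)
  exact (lt_or_ge j 0).elim (h j) fun hj => hp.nonneg j hj _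

lemma single_apply_mem (hp : IsParabolic p) {x : DhatA} (hx : x ∈ p) {j : ℤ} (hj : j ≠ 0) :
    ((Finsupp.single j (x.1 j), 0) : DhatA) ∈ p := by
  simpa [hj] using hp.graded x hx j

end IsParabolic

namespace Polynomial

lemma isCoprime_comp_X_sub_natCast {b : ℂ[X]}
    (h : ∀ x y : ℂ, b.IsRoot x → b.IsRoot y → x ≠ y → ¬ ∃ n : ℤ, x - y = (n : ℂ))
    {i j : ℕ} (hij : i ≠ j) :
    IsCoprime (b.comp (X - C (i : ℂ))) (b.comp (X - C (j : ℂ))) := by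
  rw [isCoprime_iff_aeval_ne_zero_of_isAlgClosed ℂ ℂ]
  intro a
  by_contra! ha
  simp only [aeval_comp, map_sub, aeval_X, aeval_C, coe_aeval_eq_eval] at ha
  refine h (a - i) (a - j) ha.1 ha.2 ?_ ⟨j - i, by push_cast; ring⟩
  simpa using hij

end Polynomial

open Polynomial in
lemma IsParabolic.single_mem_iff_prod_shift_dvd {p : Submodule ℂ DhatA} (hp : IsParabolic p)
    {b : ℂ[X]}
    (hb : ∀ f : ℂ[X], ((Finsupp.single (-1) f, 0) : DhatA) ∈ p ↔ b ∣ f)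
    (h : ∀ x y : ℂ, b.IsRoot x → b.IsRoot y → x ≠ y → ¬ ∃ n : ℤ, x - y = (n : ℂ))
    {k : ℕ} (hk : 1 ≤ k) (f : ℂ[X]) :
    ((Finsupp.single (-(k : ℤ)) f, 0) : DhatA) ∈ p ↔
      ∏ i ∈ Finset.range k, b.comp (X - C (i : ℂ)) ∣ f := by
  refine ⟨fun hf => Finset.prod_dvd_of_coprime
    (fun i _ j _ hij => isCoprime_comp_X_sub_natCast h hij) fun i hi =>
    hp.shift_dvd_of_single_mem (fun g => (hb g).1) hk hf (Finset.mem_range.1 hi), fun hf => ?_⟩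
  exact hp.single_mem_of_dvd (by omega) hf (hp.single_prod_shift_mem ((hb b).2 dvd_rfl) hk)

/-- Let `b` be monic and `𝔭` a parabolic subalgebra of `𝒟̂` with first characteristic
polynomial `b₁ = b`.  Then for every `k ≥ 1` the `k`-th characteristic polynomial `b_k`
divides `b^min_k(w) = b(w)b(w-1)⋯b(w-k+1)`, and
`b^max_k(w) = lcm{b(w), …, b(w-k+1)}` divides `b_k` (equivalently, each `b(w-i)`,
`0 ≤ i < k`, divides `b_k`).  In particular, if the difference of any two distinct
roots of `b` is not an integer, then `b_k = b(w)b(w-1)⋯b(w-k+1)` for every `k ≥ 1`, and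
`𝔭` is uniquely determined by `b`. -/
theorem parabolic_between_min_and_max
    (b : Polynomial ℂ) (hb : b.Monic)
    (p : Submodule ℂ DhatA) (hp : IsParabolic p)
    (bk : ℕ → Polynomial ℂ)
    (hbk : ∀ k : ℕ, 1 ≤ k → (bk k).Monic ∧
      (∀ f : Polynomial ℂ,
        ((Finsupp.single (-(k : ℤ)) f, (0 : ℂ)) : DhatA) ∈ p ↔ bk k ∣ f))
    (hb1 : bk 1 = b) :
    -- `b_k ∣ b^min_k`
    (∀ k : ℕ, 1 ≤ k →
      bk k ∣ ∏ i ∈ Finset.range k, b.comp (Polynomial.X - Polynomial.C (i : ℂ))) ∧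
    -- `b^max_k ∣ b_k`
    (∀ k : ℕ, 1 ≤ k → ∀ i : ℕ, i < k →
      b.comp (Polynomial.X - Polynomial.C (i : ℂ)) ∣ bk k) ∧
    -- the case where no two distinct roots of `b` differ by an integer
    ((∀ x y : ℂ, b.IsRoot x → b.IsRoot y → x ≠ y → ¬ ∃ n : ℤ, x - y = (n : ℂ)) →
      (∀ k : ℕ, 1 ≤ k →
        bk k = ∏ i ∈ Finset.range k, b.comp (Polynomial.X - Polynomial.C (i : ℂ))) ∧
      (∀ p' : Submodule ℂ DhatA, IsParabolic p' →
        (∀ f : Polynomial ℂ,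
          ((Finsupp.single (-1 : ℤ) f, (0 : ℂ)) : DhatA) ∈ p' ↔ b ∣ f) →
        p' = p)) := by
  have hmem : ∀ f : Polynomial ℂ, ((Finsupp.single (-1) f, 0) : DhatA) ∈ p ↔ b ∣ f := fun f => by
    simpa [hb1] using (hbk 1 le_rfl).2 f
  refine ⟨fun k hk => ?_, fun k hk i hi => ?_, fun h => ⟨fun k hk => ?_, fun p' hp' hmem' => ?_⟩⟩
  · exact ((hbk k hk).2 _).1 (hp.single_prod_shift_mem ((hmem b).2 dvd_rfl) hk)
  · exact hp.shift_dvd_of_single_mem (fun f => (hmem f).1) hk (((hbk k hk).2 _).2 dvd_rfl) hi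
  · refine Polynomial.eq_of_monic_of_associated (hbk k hk).1
      (Polynomial.monic_prod_of_monic _ _ fun i _ => hb.comp_X_sub_C _)
      (associated_of_dvd_dvd (((hbk k hk).2 _).1 ?_) ?_)
    · exact hp.single_prod_shift_mem ((hmem b).2 dvd_rfl) hk
    · exact (hp.single_mem_iff_prod_shift_dvd hmem h hk _).1
        (((hbk k hk).2 _).2 dvd_rfl)
  · have hiff : ∀ j < (0 : ℤ), ∀ f : Polynomial ℂ,
        ((Finsupp.single j f, 0) : DhatA) ∈ p' ↔ ((Finsupp.single j f, 0) : DhatA) ∈ p := by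
      intro j hj f
      obtain ⟨k, rfl⟩ : ∃ k : ℕ, j = -(k : ℤ) := ⟨j.natAbs, by omega⟩
      have hk : 1 ≤ k := by omega
      rw [hp.single_mem_iff_prod_shift_dvd hmem h hk,
        hp'.single_mem_iff_prod_shift_dvd hmem' h hk]
    ext x
    exact ⟨fun hx => hp.mem_of_single_mem fun j hj =>
        (hiff j hj _).1 (hp'.single_apply_mem hx hj.ne),
      fun hx => hp'.mem_of_single_mem fun j hj =>
        (hiff j hj _).2 (hp.single_apply_mem hx hj.ne)⟩
end

section
/- Let m ∈ ℕ, s ∈ ℂ, and let R_m = ℂ[t]/(t^{m+1}) with t̄ the class of t. Let V_m be the free R_m-module with basis (v_j)_{j∈ℤ}. Then the ℂ-linear map φ_s^{[m]} : 𝒟ᵃ → End_{R_m}(V_m) determined by φ_s^{[m]}(z^k f(D))·v_j = f(−j + s + t̄)·v_{j−k} (where f(−j+s+t̄) ∈ R_m is the evaluation of the polynomial f, equal by Taylor's formula to Σ_{i=0}^{m} (f^{(i)}(−j+s)/i!)·t̄^i) is a well-defined injective homomorphism of associative ℂ-algebras, compatible with ℤ-gradations: operators of weight k in 𝒟ᵃ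 are sent to operators mapping each v_j into R_m·v_{j−k}. -/
/-- The associative algebra `𝒟ᵃ` of regular differential operators on `ℂ^×`: all finite
sums `Σ_k z^k f_k(D)`; as a set it is the linear span of the operators `z^k f(D)`. -/
noncomputable def DaSpan : Submodule ℂ (Module.End ℂ (ℤ →₀ ℂ)) :=
  Submodule.span ℂ {T | ∃ (k : ℤ) (f : Polynomial ℂ), T = opE k f}

/-- The algebra of truncated polynomials `R_m = ℂ[t]/(t^{m+1})`. -/
abbrev Rtrunc (m : ℕ) : Type :=
  Polynomial ℂ ⧸ Ideal.span {(Polynomial.X : Polynomial ℂ) ^ (m + 1)}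

/-- The class `t̄` of `t` in `R_m = ℂ[t]/(t^{m+1})`. -/
noncomputable def tbar (m : ℕ) : Rtrunc m :=
  Ideal.Quotient.mk (Ideal.span {(Polynomial.X : Polynomial ℂ) ^ (m + 1)}) Polynomial.X

open Polynomial in
/-- The operators `v_j ↦ f(a_j) v_{j+ek}` on the free `A`-module with basis `(v_j)`, extended
linearly to finite families `(f_k)`, written `k ↦ f_k`. -/
noncomputable def shiftEval {A : Type*} [CommRing A] [Algebra ℂ A] (a : ℤ → A) (e : ℤ) :
    (ℤ →₀ ℂ[X]) →ₗ[ℂ] Module.End A (ℤ →₀ A) :=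
  Finsupp.lsum ℂ fun k =>
    { toFun := fun f => Finsupp.lsum A fun j => aeval (a j) f • Finsupp.lsingle (j + e * k)
      map_add' := fun f g => by
        ext j : 2
        simp [add_smul]
      map_smul' := fun c f => by
        ext j : 2
        simp }

namespace shiftEval

open Polynomial

variable {A B : Type*} [CommRing A] [Algebra ℂ A] [CommRing B] [Algebra ℂ B]

theorem single_apply (a : ℤ → A) (e k : ℤ) (f : ℂ[X]) (j : ℤ) (x : A) :
    shiftEval a e (Finsupp.single k f) (Finsupp.single j x) =
      Finsupp.single (j + e * k) (aeval (a j) f * x) := by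
  simp [shiftEval]

theorem apply_single_one_apply (a : ℤ → A) {e : ℤ} (he : e ≠ 0) (F : ℤ →₀ ℂ[X]) (j k : ℤ) :
    shiftEval a e F (Finsupp.single j 1) (j + e * k) = aeval (a j) (F k) := by
  induction F using Finsupp.induction_linear with
  | zero => simp
  | add F G hF hG => simp [hF, hG]
  | single l f =>
    rw [single_apply]
    by_cases h : l = k <;> simp [h, he]

theorem map_smul_algebraMap (a : ℤ → A) (e : ℤ) (c : ℂ) (F : ℤ →₀ ℂ[X]) :
    shiftEval a e (c • F) = algebraMap ℂ A c • shiftEval a e F := by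
  rw [map_smul, algebraMap_smul]

theorem injective {a : ℤ → A} {e : ℤ} (he : e ≠ 0)
    (ha : ∀ f : ℂ[X], (∀ j, aeval (a j) f = 0) → f = 0) :
    Function.Injective (shiftEval a e) := by
  rw [injective_iff_map_eq_zero]
  intro F hF
  ext1 k
  refine ha _ fun j => ?_
  rw [← apply_single_one_apply a he, hF]
  simp

theorem single_mul_single {a : ℤ → A} {e : ℤ} (ha : ∀ j k, a (j + e * k) = a j + (k : A))
    (k l : ℤ) (f g : ℂ[X]) :
    shiftEval a e (Finsupp.single k f) * shiftEval a e (Finsupp.single l g) =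
      shiftEval a e (Finsupp.single (k + l) (f.comp (X + (l : ℂ[X])) * g)) := by
  refine Finsupp.lhom_ext fun j x => ?_
  rw [Module.End.mul_apply, single_apply, single_apply, single_apply, ha]
  congr 1
  · ring
  · simp [aeval_comp, mul_assoc]

theorem exists_mul {a : ℤ → A} {b : ℤ → B} {e e' : ℤ}
    (ha : ∀ j k, a (j + e * k) = a j + (k : A)) (hb : ∀ j k, b (j + e' * k) = b j + (k : B))
    (F G : ℤ →₀ ℂ[X]) :
    ∃ H, shiftEval a e F * shiftEval a e G = shiftEval a e H ∧
      shiftEval b e' F * shiftEval b e' G = shiftEval b e' H := by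
  induction F using Finsupp.induction_linear with
  | zero => exact ⟨0, by simp⟩
  | add F₁ F₂ h₁ h₂ =>
    obtain ⟨H₁, h₁, h₁'⟩ := h₁
    obtain ⟨H₂, h₂, h₂'⟩ := h₂
    exact ⟨H₁ + H₂, by simp only [map_add, add_mul, *, and_self]⟩
  | single k f =>
    induction G using Finsupp.induction_linear with
    | zero => exact ⟨0, by simp⟩
    | add G₁ G₂ h₁ h₂ =>
      obtain ⟨H₁, h₁, h₁'⟩ := h₁
      obtain ⟨H₂, h₂, h₂'⟩ := h₂
      exact ⟨H₁ + H₂, by simp only [map_add, mul_add, *, and_self]⟩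
    | single l g => exact ⟨_, single_mul_single ha k l f g, single_mul_single hb k l f g⟩

theorem single_zero_one (a : ℤ → A) (e : ℤ) : shiftEval a e (Finsupp.single 0 1) = 1 := by
  refine Finsupp.lhom_ext fun j x => ?_
  simp [single_apply]

theorem single_eq_opE (k : ℤ) (f : ℂ[X]) :
    shiftEval (fun n : ℤ => (n : ℂ)) 1 (Finsupp.single k f) = opE k f := by
  refine Finsupp.lhom_ext fun j x => ?_
  rw [single_apply]
  simp [opE, coe_aeval_eq_eval]

theorem mem_DaSpan_iff (T : Module.End ℂ (ℤ →₀ ℂ)) :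
    T ∈ DaSpan ↔ ∃ F, shiftEval (fun n : ℤ => (n : ℂ)) 1 F = T := by
  constructor
  · intro hT
    refine (Submodule.span_le (p := LinearMap.range
      (shiftEval (fun n : ℤ => (n : ℂ)) 1))).2 ?_ hT
    rintro _ ⟨k, f, rfl⟩
    exact ⟨_, single_eq_opE k f⟩
  · rintro ⟨F, rfl⟩
    induction F using Finsupp.induction_linear with
    | zero => simp
    | add F G hF hG => simpa using add_mem hF hG
    | single k f => exact Submodule.subset_span ⟨k, f, single_eq_opE k f⟩

end shiftEval

open Polynomial in
theorem Polynomial.eq_zero_of_forall_eval_eq_zero_of_injective {f : ℂ[X]} {u : ℤ → ℂ}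
    (hu : Function.Injective u) (h : ∀ j, f.eval (u j) = 0) : f = 0 :=
  eq_zero_of_infinite_isRoot f <|
    (Set.infinite_range_of_injective hu).mono <| Set.range_subset_iff.2 h

open Polynomial in
theorem Polynomial.aeval_algebraMap_add_of_pow_eq_zero {A : Type*} [CommRing A] [Algebra ℂ A]
    {t : A} {m : ℕ} (ht : t ^ (m + 1) = 0) (c : ℂ) (f : ℂ[X]) :
    aeval (algebraMap ℂ A c + t) f =
      ∑ i ∈ Finset.range (m + 1),
        algebraMap ℂ A ((derivative^[i] f).eval c / (i.factorial : ℂ)) * t ^ i := by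
  have hcoeff (i : ℕ) : (derivative^[i] f).eval c / (i.factorial : ℂ) = (taylor c f).coeff i := by
    rw [taylor_coeff, ← factorial_smul_hasseDeriv]
    simp [Nat.factorial_ne_zero]
  have htaylor : aeval (algebraMap ℂ A c + t) f = aeval t (taylor c f) := by
    simp [taylor_apply, aeval_comp, add_comm]
  rw [htaylor, aeval_eq_sum_range' (n := m + 1 + ((taylor c f).natDegree + 1)) (by omega),
    Finset.sum_range_add]
  simp [hcoeff, pow_add t (m + 1), ht, Algebra.smul_def]

namespace Rtrunc

theorem tbar_pow (m : ℕ) : tbar m ^ (m + 1) = 0 := by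
  rw [tbar, ← map_pow]
  exact Ideal.Quotient.eq_zero_iff_mem.2 (Ideal.mem_span_singleton_self _)

/-- Setting `t̄ = 0`. -/
noncomputable def residue (m : ℕ) : Rtrunc m →ₐ[ℂ] ℂ :=
  Ideal.Quotient.liftₐ _ (Polynomial.aeval (0 : ℂ)) fun p hp => by
    obtain ⟨q, rfl⟩ := Ideal.mem_span_singleton.1 hp
    simp

theorem residue_tbar (m : ℕ) : residue m (tbar m) = 0 := by
  simp [residue, tbar]

end Rtrunc

set_option synthInstance.maxHeartbeats 1000000 in
/-- Let `m ∈ ℕ`, `s ∈ ℂ`, `R_m = ℂ[t]/(t^{m+1})` and let `V_m` be the free `R_m`-module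
with basis `(v_j)_{j∈ℤ}` (modelled as `ℤ →₀ R_m`, `v_j = single j 1`).  The `ℂ`-linear
map `φ_s^{[m]} : 𝒟ᵃ → End_{R_m}(V_m)` determined by
`φ_s^{[m]}(z^k f(D))·v_j = f(−j+s+t̄)·v_{j−k}` is a well-defined injective homomorphism
of associative `ℂ`-algebras, compatible with the `ℤ`-gradations; moreover by Taylor's
formula `f(−j+s+t̄) = Σ_{i=0}^m (f^{(i)}(−j+s)/i!)·t̄^i`. -/
theorem embedding_of_diffops_into_matrices_over_truncated_polynomials (m : ℕ) (s : ℂ) :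
    ∃ φ : ↥DaSpan → Module.End (Rtrunc m) (ℤ →₀ Rtrunc m),
      -- `φ` is additive and `ℂ`-linear
      (∀ x y : ↥DaSpan, φ (x + y) = φ x + φ y) ∧
      (∀ (c : ℂ) (x : ↥DaSpan), φ (c • x) = algebraMap ℂ (Rtrunc m) c • φ x) ∧
      -- `φ` is a homomorphism of associative algebras
      (∀ (T S : Module.End ℂ (ℤ →₀ ℂ)) (hT : T ∈ DaSpan) (hS : S ∈ DaSpan)
        (hTS : T * S ∈ DaSpan), φ ⟨T * S, hTS⟩ = φ ⟨T, hT⟩ * φ ⟨S, hS⟩) ∧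
      (∀ h1 : (1 : Module.End ℂ (ℤ →₀ ℂ)) ∈ DaSpan, φ ⟨1, h1⟩ = 1) ∧
      -- `φ` is injective
      Function.Injective φ ∧
      -- `φ` is determined by `φ(z^k f(D))·v_j = f(−j+s+t̄)·v_{j−k}`; in particular it is
      -- compatible with the principal `ℤ`-gradations (weight `k` operators send `v_j`
      -- into `R_m·v_{j-k}`)
      (∀ (k : ℤ) (f : Polynomial ℂ) (h : opE k f ∈ DaSpan) (j : ℤ),
        φ ⟨opE k f, h⟩ (Finsupp.single j 1)
          = Finsupp.single (j - k)
              (Polynomial.aeval (algebraMap ℂ (Rtrunc m) (-(j : ℂ) + s) + tbar m) f)) ∧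
      -- Taylor's formula for the evaluation `f(−j+s+t̄)`
      (∀ (f : Polynomial ℂ) (j : ℤ),
        Polynomial.aeval (algebraMap ℂ (Rtrunc m) (-(j : ℂ) + s) + tbar m) f
          = ∑ i ∈ Finset.range (m + 1),
              algebraMap ℂ (Rtrunc m)
                ((Polynomial.derivative^[i] f).eval (-(j : ℂ) + s) / (i.factorial : ℂ))
                * tbar m ^ i) := by
  let b : ℤ → Rtrunc m := fun j => algebraMap ℂ (Rtrunc m) (-(j : ℂ) + s) + tbar m
  have hb (j k : ℤ) : b (j + -1 * k) = b j + (k : Rtrunc m) := by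
    simp only [b, map_add, map_neg, map_intCast]
    push_cast
    ring
  have hb' (f : Polynomial ℂ) (h : ∀ j : ℤ, Polynomial.aeval (b j) f = 0) : f = 0 := by
    refine Polynomial.eq_zero_of_forall_eval_eq_zero_of_injective
      (u := fun j : ℤ => -(j : ℂ) + s) (fun i j hij => by simpa using hij) fun j => ?_
    have := congrArg (Rtrunc.residue m) (h j)
    rwa [← Polynomial.aeval_algHom_apply, map_add, AlgHom.commutes, Rtrunc.residue_tbar,
      add_zero, map_zero] at this
  have ha (j k : ℤ) : ((j + 1 * k : ℤ) : ℂ) = (j : ℂ) + (k : ℂ) := by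
    simp
  have hinj : Function.Injective (shiftEval (fun n : ℤ => (n : ℂ)) 1) :=
    shiftEval.injective one_ne_zero fun f hf =>
      Polynomial.eq_zero_of_forall_eval_eq_zero_of_injective Int.cast_injective hf
  choose symbol hsymbol using fun x : DaSpan => (shiftEval.mem_DaSpan_iff x.1).1 x.2
  have symbol_eq (x : DaSpan) (F) (h : shiftEval (fun n : ℤ => (n : ℂ)) 1 F = x.1) :
      symbol x = F := hinj ((hsymbol x).trans h.symm)
  refine ⟨fun x => shiftEval b (-1) (symbol x), fun x y => ?_, fun c x => ?_,
    fun T S hT hS hTS => ?_, fun h1 => ?_, fun x y hxy => ?_, fun k f h j => ?_, fun f j => ?_⟩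
  · beta_reduce
    rw [symbol_eq (x + y) (symbol x + symbol y) (by simp [hsymbol]), map_add]
  · beta_reduce
    rw [symbol_eq (c • x) (c • symbol x) (by simp [hsymbol]), shiftEval.map_smul_algebraMap]
  · obtain ⟨H, hH, hH'⟩ := shiftEval.exists_mul ha hb (symbol ⟨T, hT⟩) (symbol ⟨S, hS⟩)
    rw [hsymbol, hsymbol] at hH
    beta_reduce
    rw [symbol_eq ⟨T * S, hTS⟩ H hH.symm, hH']
  · beta_reduce
    rw [symbol_eq ⟨1, h1⟩ _ (shiftEval.single_zero_one _ _), shiftEval.single_zero_one]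
  · have := shiftEval.injective (by simp) hb' hxy
    exact Subtype.ext (by rw [← hsymbol, ← hsymbol, this])
  · beta_reduce
    rw [symbol_eq ⟨opE k f, h⟩ _ (shiftEval.single_eq_opE k f), shiftEval.single_apply, mul_one,
      neg_one_mul, sub_eq_add_neg]
  · exact Polynomial.aeval_algebraMap_add_of_pow_eq_zero (Rtrunc.tbar_pow m) _ f
end
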